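/- arXiv:1904.02267 — 2 statements merged into one kernel-verified Lean document; each statement's English description precedes it below -/
import Mathlib

section
/- For every positive integer d, the number of strictly monotone sequences of transpositions in S_d (of any length, including the empty sequence) equals d!. -/
open Equiv

namespace FSM

/-- The number of cycles of a permutation (counting fixed points), i.e. the number of
orbits, realised as the cardinality of the quotient of the underlying set by the
`SameCycle` relation. -/
noncomputable def cycleCount {α : Type*} (σ : Perm α) : ℕ :=
  Nat.card (Quot σ.SameCycle)

/-- The size of the cycle (orbit) of `σ` containing `x`, counting fixed points as
cycles of length `1`. -/
noncomputable def orbitSize {α : Type*} (σ : Perm α) (x : α) : ℕ :=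
  Nat.card {y : α // σ.SameCycle x y}

/-- The cycle type of a permutation including parts equal to `1` for the fixed points. -/
noncomputable def fullCycleType {α : Type*} [Fintype α] [DecidableEq α] (σ : Perm α) :
    Multiset ℕ :=
  σ.cycleType + Multiset.replicate (Fintype.card α - σ.support.card) 1

/-- A list of permutations is a strictly monotone sequence of transpositions if each
entry is a transposition `(aᵢ bᵢ)` with `aᵢ < bᵢ` and the sequence `b₁, b₂, …` is
strictly increasing. -/
def IsStrictlyMonotone {d : ℕ} (l : List (Perm (Fin d))) : Prop :=
  ∃ ab : List (Fin d × Fin d),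
    l = ab.map (fun p => Equiv.swap p.1 p.2) ∧
    (∀ p ∈ ab, p.1 < p.2) ∧
    List.Chain' (· < ·) (ab.map Prod.snd)

/-- A list of permutations is a weakly monotone sequence of transpositions if each
entry is a transposition `(aᵢ bᵢ)` with `aᵢ < bᵢ` and the sequence `b₁, b₂, …` is
weakly increasing. -/
def IsWeaklyMonotone {d : ℕ} (l : List (Perm (Fin d))) : Prop :=
  ∃ ab : List (Fin d × Fin d),
    l = ab.map (fun p => Equiv.swap p.1 p.2) ∧
    (∀ p ∈ ab, p.1 < p.2) ∧
    List.Chain' (· ≤ ·) (ab.map Prod.snd)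

/-- The strictly monotone Hurwitz number `H^<_k(λ; μ)`: `1/d!` times the number of
tuples `(ρ_λ, τ₁, …, τ_k, ρ_μ)` with `ρ_λ` of cycle type `λ`, `ρ_μ` of cycle type `μ`,
`τ₁, …, τ_k` a strictly monotone sequence of transpositions and
`ρ_λ τ₁ ⋯ τ_k ρ_μ = id`. -/
noncomputable def Hstrict (d k : ℕ) (lam mu : Nat.Partition d) : ℚ :=
  (Nat.card {t : Perm (Fin d) × List (Perm (Fin d)) × Perm (Fin d) //
      fullCycleType t.1 = lam.parts ∧ fullCycleType t.2.2 = mu.parts ∧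
      t.2.1.length = k ∧ IsStrictlyMonotone t.2.1 ∧
      t.1 * t.2.1.prod * t.2.2 = 1} : ℚ) / (d.factorial : ℚ)

/-- The weakly monotone Hurwitz number `H^≤_k(λ; μ)`. -/
noncomputable def Hweak (d k : ℕ) (lam mu : Nat.Partition d) : ℚ :=
  (Nat.card {t : Perm (Fin d) × List (Perm (Fin d)) × Perm (Fin d) //
      fullCycleType t.1 = lam.parts ∧ fullCycleType t.2.2 = mu.parts ∧
      t.2.1.length = k ∧ IsWeaklyMonotone t.2.1 ∧
      t.1 * t.2.1.prod * t.2.2 = 1} : ℚ) / (d.factorial : ℚ)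

/-- `z(λ) = ∏ᵢ λᵢ · ∏ⱼ mⱼ(λ)!`. -/
def zPart {d : ℕ} (lam : Nat.Partition d) : ℕ :=
  lam.parts.prod * ∏ j ∈ lam.parts.toFinset, (lam.parts.count j).factorial

end FSM
namespace FSM

/-- The pairs `(f b, b)` with `f b < b`, listed by increasing `b`. -/
def descentPairs {d : ℕ} (f : ∀ b : Fin d, Finset.Iic b) : List (Fin d × Fin d) :=
  ((List.finRange d).map fun b => ((f b : Fin d), b)).filter fun p => p.1 < p.2

lemma mem_descentPairs {d : ℕ} {f : ∀ b : Fin d, Finset.Iic b} {p : Fin d × Fin d} :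
    p ∈ descentPairs f ↔ (f p.2 : Fin d) = p.1 ∧ p.1 < p.2 := by
  obtain ⟨a, b⟩ := p
  simp [descentPairs]

lemma pairwise_descentPairs {d : ℕ} (f : ∀ b : Fin d, Finset.Iic b) :
    (descentPairs f).Pairwise fun p q => p.2 < q.2 := by
  refine List.Pairwise.filter _ ?_
  rw [List.pairwise_map]
  exact List.pairwise_lt_finRange d

lemma descentPairs_injective {d : ℕ} :
    Function.Injective (descentPairs : (∀ b : Fin d, Finset.Iic b) → _) := by
  intro f g h
  funext b
  have key : ∀ a : Fin d, (f b : Fin d) = a ∧ a < b ↔ (g b : Fin d) = a ∧ a < b := fun a => by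
    simpa only [mem_descentPairs] using iff_of_eq (congrArg ((a, b) ∈ ·) h)
  have hf := Finset.mem_Iic.1 (f b).2
  have hg := Finset.mem_Iic.1 (g b).2
  apply Subtype.ext
  rcases hf.lt_or_eq with h1 | h1
  · exact ((key _).1 ⟨rfl, h1⟩).1.symm
  rcases hg.lt_or_eq with h2 | h2
  · exact ((key _).2 ⟨rfl, h2⟩).1
  · rw [h1, h2]

lemma exists_descentPairs_eq {d : ℕ} {ab : List (Fin d × Fin d)} (hlt : ∀ p ∈ ab, p.1 < p.2)
    (hab : ab.Pairwise fun p q => p.2 < q.2) :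
    ∃ f : ∀ b : Fin d, Finset.Iic b, descentPairs f = ab := by
  have hnd : (ab.map Prod.snd).Nodup := List.pairwise_map.2 (hab.imp fun h => h.ne)
  have huniq : ∀ p ∈ ab, ∀ q ∈ ab, p.2 = q.2 → p = q := fun p hp q hq hpq =>
    List.inj_on_of_nodup_map hnd hp hq hpq
  have hex : ∀ b : Fin d, ∃ a : Finset.Iic b,
      ∀ c : Fin d, (a : Fin d) = c ∧ c < b ↔ (c, b) ∈ ab := by
    intro b
    by_cases h : ∃ a, (a, b) ∈ ab
    · obtain ⟨a, ha⟩ := h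
      refine ⟨⟨a, Finset.mem_Iic.2 (hlt _ ha).le⟩, fun c => ⟨?_, fun hc => ?_⟩⟩
      · rintro ⟨rfl, -⟩
        exact ha
      · exact ⟨congrArg Prod.fst (huniq _ ha _ hc rfl), hlt _ hc⟩
    · refine ⟨⟨b, Finset.mem_Iic.2 le_rfl⟩, fun c => ⟨?_, fun hc => (h ⟨c, hc⟩).elim⟩⟩
      rintro ⟨rfl, hc⟩
      exact (lt_irrefl _ hc).elim
  choose f hf using hex
  refine ⟨f, ?_⟩
  have nodup : ∀ {l : List (Fin d × Fin d)}, l.Pairwise (fun p q => p.2 < q.2) → l.Nodup :=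
    fun h => h.imp fun h e => h.ne (congrArg Prod.snd e)
  refine List.Perm.eq_of_pairwise (fun p q _ _ h h' => (lt_asymm h h').elim)
    (pairwise_descentPairs f) hab
    ((List.perm_ext_iff_of_nodup (nodup (pairwise_descentPairs f)) (nodup hab)).2 fun p => ?_)
  rw [mem_descentPairs, hf]

lemma swap_injOn_lt {α : Type*} [LinearOrder α] :
    Set.InjOn (fun p : α × α => Equiv.swap p.1 p.2) {p | p.1 < p.2} := by
  rintro ⟨a, b⟩ hab ⟨c, e⟩ hce h
  simp only [Set.mem_ofPred_eq] at hab hce h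
  have h1 := Equiv.congr_fun h a
  have h2 := Equiv.congr_fun h b
  simp only [Equiv.swap_apply_left, Equiv.swap_apply_right, Equiv.swap_apply_def] at h1 h2
  grind

lemma map_swap_injOn {α : Type*} [LinearOrder α] :
    Set.InjOn (List.map fun p : α × α => Equiv.swap p.1 p.2) {l | ∀ p ∈ l, p.1 < p.2} := by
  intro l
  induction l with
  | nil => intro _ m _ h; exact (List.map_eq_nil_iff.1 h.symm).symm
  | cons p l ih =>
    rintro hl (_ | ⟨q, m⟩) hm h
    · simp at h
    · simp only [Set.mem_ofPred_eq, List.forall_mem_cons] at hl hm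
      simp only [List.map_cons, List.cons.injEq] at h
      rw [swap_injOn_lt hl.1 hm.1 h.1, ih hl.2 hm.2 h.2]

lemma isStrictlyMonotone_iff {d : ℕ} {l : List (Perm (Fin d))} :
    IsStrictlyMonotone l ↔
      ∃ f : ∀ b : Fin d, Finset.Iic b,
        (descentPairs f).map (fun p => Equiv.swap p.1 p.2) = l := by
  have chain : ∀ ab : List (Fin d × Fin d), List.IsChain (· < ·) (ab.map Prod.snd) ↔
      ab.Pairwise fun p q => p.2 < q.2 := fun ab => by
    rw [List.isChain_iff_pairwise, List.pairwise_map]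
  constructor
  · rintro ⟨ab, rfl, hlt, hc⟩
    obtain ⟨f, rfl⟩ := exists_descentPairs_eq hlt ((chain ab).1 hc)
    exact ⟨f, rfl⟩
  · rintro ⟨f, rfl⟩
    exact ⟨descentPairs f, rfl, fun p hp => (mem_descentPairs.1 hp).2,
      (chain _).2 (pairwise_descentPairs f)⟩

end FSM

open FSM in
/-- **The number of strictly monotone sequences of transpositions in `S_d` equals `d!`.** -/
theorem card_strictlyMonotone_eq_factorial (d : ℕ) (hd : 0 < d) :
    Nat.card {l : List (Equiv.Perm (Fin d)) // IsStrictlyMonotone l} = d.factorial := by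
  have hinj : Function.Injective fun f : ∀ b : Fin d, Finset.Iic b =>
      (descentPairs f).map fun p => Equiv.swap p.1 p.2 := fun f g h =>
    descentPairs_injective (map_swap_injOn (fun _ hp => (mem_descentPairs.1 hp).2)
      (fun _ hp => (mem_descentPairs.1 hp).2) h)
  have hcard : Nat.card {l : List (Equiv.Perm (Fin d)) // IsStrictlyMonotone l} =
      Nat.card (∀ b : Fin d, Finset.Iic b) :=
    Nat.card_congr (((Equiv.ofInjective _ hinj).trans
      (Equiv.subtypeEquivRight fun _ => isStrictlyMonotone_iff.symm)).symm)
  rw [hcard, Nat.card_eq_fintype_card, Fintype.card_pi]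
  simp only [Fintype.card_coe, Fin.card_Iic]
  rw [Fin.prod_univ_eq_prod_range (fun i => i + 1), Finset.prod_range_add_one_eq_factorial]
end

section
/- Let λ = (λ_1, …, λ_ℓ) and μ be partitions of a positive integer d and let k ≥ 0 be an integer. Let D_k(λ; μ) be the number of equivalence classes of dessins d'enfant (τ_r, τ_b, τ_v; R) on a set E of d edges such that the cycle of τ_b containing r_i has length λ_i for i = 1, …, ℓ, the cycle type of τ_r is μ, and the number of edges exceeds the number of cycles of τ_v (counting fixed points) by k. Then D_k(λ; μ) = z(λ) · H^<_k(λ; μ). -/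
open Equiv

namespace FSM

/-- The permutation model of a dessin d'enfant with `n` (ordered, rooted) blue faces on
the set `Fin m` of edges: `tr tb tv = id` and each cycle of `tb` contains exactly one
entry of the root tuple `R`. -/
structure DessinData (m n : ℕ) where
  tr : Perm (Fin m)
  tb : Perm (Fin m)
  tv : Perm (Fin m)
  R : Fin n → Fin m
  rel : tr * tb * tv = 1
  unique_root : ∀ x : Fin m, ∃! i, tb.SameCycle (R i) x

/-- Equivalence of dessins d'enfant: a relabelling of the edges conjugating the three
permutations and carrying the tuple of roots to the tuple of roots. -/
def DessinEquivRel {m n : ℕ} (M M' : DessinData m n) : Prop :=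
  ∃ φ : Perm (Fin m),
    φ * M.tr * φ⁻¹ = M'.tr ∧ φ * M.tb * φ⁻¹ = M'.tb ∧ φ * M.tv * φ⁻¹ = M'.tv ∧
    ∀ i, φ (M.R i) = M'.R i

end FSM
namespace FSM

section Cycles

variable {α : Type*}

theorem rel_of_sameCycle {σ : Perm α} (s : Setoid α) (h : ∀ x, s x (σ x)) {x y : α}
    (hxy : σ.SameCycle x y) : s x y := by
  obtain ⟨i, rfl⟩ := hxy
  induction i with
  | zero => exact s.refl x
  | succ i ih =>
    rw [add_comm, zpow_add, zpow_one, Perm.mul_apply]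
    exact s.trans ih (h _)
  | pred i ih =>
    refine s.trans ih (s.symm ?_)
    have := h ((σ ^ (-(i : ℤ) - 1)) x)
    rwa [← Perm.mul_apply, ← zpow_one_add, add_sub_cancel] at this

theorem mk_eq_iff_sameCycle {σ : Perm α} {x y : α} :
    Quot.mk σ.SameCycle x = Quot.mk σ.SameCycle y ↔ σ.SameCycle x y :=
  Quotient.eq (r := Perm.SameCycle.setoid σ)

theorem cycleCount_one : cycleCount (1 : Perm α) = Nat.card α := by
  refine (Nat.card_congr (Equiv.ofBijective (Quot.mk _) ⟨fun x y h => ?_, Quot.mk_surjective⟩)).symm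
  simpa using mk_eq_iff_sameCycle.1 h

/-- Right multiplication by the transposition of a fixed point and another point merges the cycle
of the fixed point into that of the other point. -/
theorem sameCycle_mul_swap_iff [DecidableEq α] {σ : Perm α} {a b : α} (hab : a ≠ b)
    (hb : σ b = b) (x y : α) :
    (σ * swap a b).SameCycle x y ↔
      σ.SameCycle (if x = b then a else x) (if y = b then a else y) := by
  have ha : σ a ≠ b := fun h => hab (σ.injective (h.trans hb.symm))
  set τ := σ * swap a b with hτ
  have τa : τ a = b := by simp [hτ, hb]
  have τb : τ b = σ a := by simp [hτ]
  have τx : ∀ x, x ≠ a → x ≠ b → τ x = σ x := fun x h1 h2 => by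
    simp [hτ, swap_apply_of_ne_of_ne h1 h2]
  constructor
  · intro h
    refine rel_of_sameCycle
      ((Perm.SameCycle.setoid σ).comap fun x => if x = b then a else x) (fun x => ?_) h
    change σ.SameCycle _ _
    by_cases h1 : x = b
    · subst h1
      simp [τb, ha, Perm.SameCycle.refl]
    by_cases h2 : x = a
    · subst h2
      simp [τa, Perm.SameCycle.refl]
    · have : σ x ≠ b := fun h => h1 (σ.injective (h.trans hb.symm))
      simp [h1, τx x h2 h1, this, Perm.SameCycle.refl]
  · intro h
    have hr : ∀ x, τ.SameCycle x (if x = b then a else x) := fun x => by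
      split_ifs with h1
      · rw [h1, ← τa]
        simp [Perm.SameCycle.refl]
      · rfl
    refine (hr x).trans (Perm.SameCycle.trans ?_ (hr y).symm)
    refine rel_of_sameCycle (Perm.SameCycle.setoid τ) (fun x => ?_) h
    change τ.SameCycle _ _
    by_cases h1 : x = b
    · rw [h1, hb]
    by_cases h2 : x = a
    · rw [h2, ← τb, ← τa]
      simp [Perm.SameCycle.refl]
    · rw [← τx x h2 h1]
      simp [Perm.SameCycle.refl]

theorem cycleCount_mul_swap [Finite α] [DecidableEq α] {σ : Perm α} {a b : α} (hab : a ≠ b)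
    (hb : σ b = b) : cycleCount (σ * swap a b) + 1 = cycleCount σ := by
  have key := sameCycle_mul_swap_iff hab hb
  let r : α → α := fun x => if x = b then a else x
  have hr : ∀ x, r x ≠ b := fun x => by
    simp only [r]
    split_ifs with h
    exacts [hab, h]
  have hfix : ∀ y, σ.SameCycle b y → y = b := fun y ⟨i, hi⟩ =>
    hi.symm.trans (Perm.zpow_apply_eq_self_of_apply_eq_self hb i)
  let f : Option (Quot (σ * swap a b).SameCycle) → Quot σ.SameCycle := fun o =>
    o.elim (Quot.mk _ b) (Quot.map r fun x y h => (key x y).1 h)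
  have hf : Function.Bijective f := by
    constructor
    · rintro (_ | x) (_ | y) h
      · rfl
      · induction y using Quot.ind with | mk y
        exact absurd (hfix _ (mk_eq_iff_sameCycle.1 h)) (hr y)
      · induction x using Quot.ind with | mk x
        exact absurd (hfix _ (mk_eq_iff_sameCycle.1 h.symm)) (hr x)
      · induction x using Quot.ind with | mk x
        induction y using Quot.ind with | mk y
        exact congrArg some (Quot.sound ((key x y).2 (mk_eq_iff_sameCycle.1 h)))
    · rintro ⟨x⟩
      by_cases h : x = b
      · exact ⟨none, by rw [h]; rfl⟩
      · refine ⟨some (Quot.mk _ x), ?_⟩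
        change Quot.mk _ (if x = b then a else x) = _
        rw [if_neg h]
  have : Finite (Quot (σ * swap a b).SameCycle) := Finite.of_surjective _ Quot.mk_surjective
  rw [cycleCount, cycleCount, ← Finite.card_option]
  exact Nat.card_congr (Equiv.ofBijective f hf)

theorem orbitSize_eq_of_sameCycle {σ : Perm α} {x y : α} (h : σ.SameCycle x y) :
    orbitSize σ x = orbitSize σ y :=
  Nat.card_congr (Equiv.subtypeEquivRight fun _ => ⟨h.symm.trans, h.trans⟩)

theorem orbitSize_conj (φ σ : Perm α) (x : α) : orbitSize (φ * σ * φ⁻¹) (φ x) = orbitSize σ x :=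
  (Nat.card_congr (φ.subtypeEquiv fun _ => by simp [Perm.sameCycle_conj])).symm

theorem orbitSize_eq_minimalPeriod [Finite α] (σ : Perm α) (x : α) :
    orbitSize σ x = Function.minimalPeriod (σ • ·) x := by
  have := Fintype.ofFinite (MulAction.orbit (Subgroup.zpowers σ) x)
  rw [MulAction.minimalPeriod_eq_card, ← Nat.card_eq_fintype_card]
  refine Nat.card_congr (Equiv.subtypeEquivRight fun y => ?_)
  simp [Perm.SameCycle, MulAction.mem_orbit_iff, Subgroup.smul_def, Subgroup.exists_zpowers]

theorem zpow_apply_eq_zpow_apply_iff [Finite α] (σ : Perm α) (x : α) (i j : ℤ) :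
    (σ ^ i) x = (σ ^ j) x ↔ (orbitSize σ x : ℤ) ∣ i - j := by
  rw [orbitSize_eq_minimalPeriod, ← MulAction.zpow_smul_eq_iff_minimalPeriod_dvd,
    Perm.smul_def, sub_eq_neg_add, zpow_add, zpow_neg, Perm.mul_apply, Perm.inv_eq_iff_eq, eq_comm]

theorem orbitSize_of_apply_eq {σ : Perm α} {x : α} (h : σ x = x) : orbitSize σ x = 1 := by
  have : Unique {y // σ.SameCycle x y} :=
    ⟨⟨⟨x, .refl _ _⟩⟩, fun ⟨y, i, hi⟩ => Subtype.ext
      (hi.symm.trans (Perm.zpow_apply_eq_self_of_apply_eq_self h i))⟩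
  exact Nat.card_unique

variable [Fintype α] [DecidableEq α]

theorem fullCycleType_conj (φ σ : Perm α) :
    fullCycleType (φ * σ * φ⁻¹) = fullCycleType σ := by
  simp [fullCycleType, Perm.cycleType_conj]

theorem orbitSize_of_apply_ne {σ : Perm α} {x : α} (h : σ x ≠ x) :
    orbitSize σ x = (σ.cycleOf x).support.card := by
  rw [← Fintype.card_coe, ← Nat.card_eq_fintype_card]
  exact Nat.card_congr (Equiv.subtypeEquivRight fun y => (Perm.mem_support_cycleOf_iff' h).symm)

/-- The full cycle type is the multiset of orbit sizes. -/
theorem map_orbitSize_out (σ : Perm α) [Fintype (Quot σ.SameCycle)] :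
    (Finset.univ : Finset (Quot σ.SameCycle)).val.map (fun q => orbitSize σ q.out) =
      fullCycleType σ := by
  classical
  have hout : ∀ q : Quot σ.SameCycle, Quot.mk _ q.out = q := Quot.out_eq
  have hfix : ∀ x, σ x = x → (Quot.mk σ.SameCycle x).out = x := fun x hx => by
    obtain ⟨i, hi⟩ := mk_eq_iff_sameCycle.1 (hout (Quot.mk _ x)).symm
    rw [← hi, Perm.zpow_apply_eq_self_of_apply_eq_self hx]
  rw [← Multiset.filter_add_not (fun q : Quot σ.SameCycle => σ q.out ≠ q.out) Finset.univ.val,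
    Multiset.map_add, fullCycleType, Perm.cycleType_def]
  congr 1
  · refine Multiset.map_eq_map_of_bij_of_nodup _ _ (Finset.univ.nodup.filter _)
      σ.cycleFactorsFinset.nodup (fun q _ => σ.cycleOf q.out) ?_ ?_ ?_ ?_
    · intro q hq
      exact Perm.cycleOf_mem_cycleFactorsFinset_iff.2
        (Perm.mem_support.2 (Multiset.mem_filter.1 hq).2)
    · intro q hq q' hq' h
      rw [← hout q, ← hout q', mk_eq_iff_sameCycle]
      exact (Perm.sameCycle_iff_cycleOf_eq_of_mem_support
        (Perm.mem_support.2 (Multiset.mem_filter.1 hq).2)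
        (Perm.mem_support.2 (Multiset.mem_filter.1 hq').2)).2 h
    · intro c hc
      obtain ⟨x, hx⟩ := (Perm.mem_cycleFactorsFinset_iff.1 hc).1.nonempty_support
      have hxc := Perm.cycle_is_cycleOf hx hc
      have hx' : x ∈ σ.support := by
        rw [← Perm.cycleOf_mem_cycleFactorsFinset_iff, ← hxc]
        exact hc
      have hs : σ.SameCycle x (Quot.mk σ.SameCycle x).out :=
        mk_eq_iff_sameCycle.1 (hout (Quot.mk _ x)).symm
      have hne : (Quot.mk σ.SameCycle x).out ∈ σ.support := by
        rw [Perm.mem_support] at hx' ⊢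
        exact fun h => hx' (hs.apply_eq_self_iff.2 h)
      exact ⟨Quot.mk _ x, Multiset.mem_filter.2 ⟨Finset.mem_univ _, Perm.mem_support.1 hne⟩,
        hxc.symm ▸ ((Perm.sameCycle_iff_cycleOf_eq_of_mem_support hx' hne).1 hs).symm⟩
    · intro q hq
      exact orbitSize_of_apply_ne (Multiset.mem_filter.1 hq).2
  · rw [Multiset.eq_replicate, Multiset.card_map]
    constructor
    · rw [← Finset.card_compl, ← Finset.filter_val, Finset.card_val]
      refine Finset.card_bij (fun q _ => q.out) ?_ ?_ ?_
      · intro q hq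
        simpa using hq
      · intro q _ q' _ h
        rw [← hout q, ← hout q', h]
      · intro x hx
        have hx' : σ x = x := by simpa using hx
        exact ⟨Quot.mk _ x, by simp [hfix x hx', hx'], hfix x hx'⟩
    · intro n hn
      obtain ⟨q, hq, rfl⟩ := Multiset.mem_map.1 hn
      exact orbitSize_of_apply_eq (not_not.1 (Multiset.mem_filter.1 hq).2)

end Cycles

section Factorization

variable {d : ℕ}

theorem isStrictlyMonotone_iff_pairwise {l : List (Perm (Fin d))} :
    IsStrictlyMonotone l ↔ ∃ ab : List (Fin d × Fin d),
      l = ab.map (fun p => Equiv.swap p.1 p.2) ∧ (∀ p ∈ ab, p.1 < p.2) ∧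
      (ab.map Prod.snd).Pairwise (· < ·) :=
  exists_congr fun _ => and_congr_right fun _ => and_congr_right fun _ =>
    List.isChain_iff_pairwise

theorem prod_map_swap_apply_of_lt (ab : List (Fin d × Fin d)) (x : Fin d)
    (h : ∀ p ∈ ab, p.1 < p.2) (hx : ∀ p ∈ ab, p.2 < x) :
    (ab.map (fun p => Equiv.swap p.1 p.2)).prod x = x := by
  induction ab with
  | nil => rfl
  | cons p ab ih =>
    simp only [List.forall_mem_cons] at h hx
    rw [List.map_cons, List.prod_cons, Perm.mul_apply, ih h.2 hx.2,
      swap_apply_of_ne_of_ne (h.1.trans hx.1).ne' hx.1.ne']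

theorem IsStrictlyMonotone.of_concat {l : List (Perm (Fin d))} {t : Perm (Fin d)}
    (h : IsStrictlyMonotone (l ++ [t])) :
    IsStrictlyMonotone l ∧ ∃ a b : Fin d, a < b ∧ t = swap a b ∧ ∀ x, b ≤ x → l.prod x = x := by
  rw [isStrictlyMonotone_iff_pairwise] at h
  obtain ⟨ab, hl, hlt, hp⟩ := h
  induction ab using List.reverseRecOn with
  | nil => simp at hl
  | append_singleton ab p _ =>
    rw [List.map_append, List.map_singleton, List.append_singleton_inj] at hl
    obtain ⟨rfl, rfl⟩ := hl
    rw [List.map_append, List.pairwise_append] at hp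
    have hlt' : ∀ q ∈ ab, q.1 < q.2 := fun q hq => hlt q (by simp [hq])
    refine ⟨isStrictlyMonotone_iff_pairwise.2 ⟨ab, rfl, hlt', hp.1⟩,
      p.1, p.2, hlt p (by simp), rfl, fun x hx => ?_⟩
    exact prod_map_swap_apply_of_lt ab x hlt' fun q hq =>
      (hp.2.2 q.2 (List.mem_map_of_mem hq) p.2 (by simp)).trans_le hx

theorem IsStrictlyMonotone.cycleCount_prod_add_length {l : List (Perm (Fin d))}
    (h : IsStrictlyMonotone l) : cycleCount l.prod + l.length = d := by
  induction l using List.reverseRecOn with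
  | nil => simp [cycleCount_one]
  | append_singleton l t ih =>
    obtain ⟨hl, a, b, hab, rfl, hfix⟩ := h.of_concat
    have h1 := cycleCount_mul_swap hab.ne (hfix b le_rfl)
    have h2 := ih hl
    simp only [List.prod_append, List.prod_singleton, List.length_append, List.length_singleton]
    omega

/-- If `σ` fixes all points from `b` on, then `b` is the largest point moved by `σ * swap a b`,
and `a` is its preimage. -/
theorem mul_swap_apply_of_fixed {σ : Perm (Fin d)} {a b : Fin d} (hab : a < b)
    (hfix : ∀ x, b ≤ x → σ x = x) :
    (σ * swap a b) a = b ∧ (∀ x, b < x → (σ * swap a b) x = x) ∧ (σ * swap a b) b ≠ b := by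
  refine ⟨by simp [hfix b le_rfl], fun x hx => ?_, ?_⟩
  · rw [Perm.mul_apply, swap_apply_of_ne_of_ne (hab.trans hx).ne' hx.ne', hfix x hx.le]
  · rw [Perm.mul_apply, swap_apply_right]
    exact fun h => hab.ne (σ.injective (h.trans (hfix b le_rfl).symm))

theorem IsStrictlyMonotone.eq_of_prod_eq {l l' : List (Perm (Fin d))}
    (h : IsStrictlyMonotone l) (h' : IsStrictlyMonotone l') (hp : l.prod = l'.prod) : l = l' := by
  induction l using List.reverseRecOn generalizing l' with
  | nil =>
    have h1 := h.cycleCount_prod_add_length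
    have h2 := h'.cycleCount_prod_add_length
    rw [hp] at h1
    exact (List.length_eq_zero_iff.1 (by simp at h1; omega)).symm
  | append_singleton l t ih =>
    induction l' using List.reverseRecOn with
    | nil =>
      have h1 := h.cycleCount_prod_add_length
      have h2 := h'.cycleCount_prod_add_length
      rw [hp] at h1
      simp at h1 h2
      omega
    | append_singleton l' t' _ =>
      obtain ⟨hl, a, b, hab, rfl, hfix⟩ := h.of_concat
      obtain ⟨hl', a', b', hab', rfl, hfix'⟩ := h'.of_concat
      simp only [List.prod_append, List.prod_singleton] at hp
      obtain ⟨h1, h2, h3⟩ := mul_swap_apply_of_fixed hab hfix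
      obtain ⟨h1', h2', h3'⟩ := mul_swap_apply_of_fixed hab' hfix'
      rw [hp] at h1 h2 h3
      obtain rfl : b = b' := le_antisymm (not_lt.1 fun hlt => h3 (h2' b hlt))
        (not_lt.1 fun hlt => h3' (h2 b' hlt))
      obtain rfl : a = a' := Equiv.injective _ (h1.trans h1'.symm)
      rw [ih hl hl' (mul_right_cancel hp)]

theorem exists_isStrictlyMonotone_prod_eq (σ : Perm (Fin d)) :
    ∃ l, IsStrictlyMonotone l ∧ l.prod = σ := by
  suffices H : ∀ m : ℕ, ∀ σ : Perm (Fin d), (∀ x : Fin d, m ≤ x → σ x = x) →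
      ∃ ab : List (Fin d × Fin d), (∀ p ∈ ab, p.1 < p.2) ∧ (∀ p ∈ ab, (p.2 : ℕ) < m) ∧
        (ab.map Prod.snd).Pairwise (· < ·) ∧ (ab.map (fun p => Equiv.swap p.1 p.2)).prod = σ by
    obtain ⟨ab, h1, -, h2, h3⟩ := H d σ fun x hx => absurd x.2 (not_lt.2 hx)
    exact ⟨_, isStrictlyMonotone_iff_pairwise.2 ⟨ab, rfl, h1, h2⟩, h3⟩
  intro m
  induction m with
  | zero => exact fun σ h => ⟨[], by simp, by simp, by simp, (Equiv.ext fun x => h x (by simp)).symm⟩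
  | succ m ih =>
    intro σ hσ
    by_cases hm : ∀ x : Fin d, (x : ℕ) = m → σ x = x
    · obtain ⟨ab, h1, h2, h3⟩ := ih σ fun x hx => by
        rcases hx.eq_or_lt with h | h
        exacts [hm x h.symm, hσ x h]
      exact ⟨ab, h1, fun p hp => (h2 p hp).trans m.lt_succ_self, h3⟩
    · push Not at hm
      obtain ⟨b, rfl, hb⟩ := hm
      obtain ⟨a, ha⟩ := σ.surjective b
      have hab : a < b := by
        rcases lt_trichotomy a b with h | h | h
        · exact h
        · exact absurd (h ▸ ha) hb
        · exact absurd ((hσ a h).symm.trans ha) h.ne'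
      obtain ⟨ab, h1, h2, h3, h4⟩ := ih (σ * swap a b) fun x hx => by
        rcases hx.eq_or_lt with h | h
        · obtain rfl : b = x := Fin.ext h
          simp [ha]
        · rw [Perm.mul_apply, swap_apply_of_ne_of_ne (hab.trans h).ne' (Fin.ne_of_gt h), hσ x h]
      refine ⟨ab ++ [(a, b)], ?_, ?_, ?_, ?_⟩
      · simpa [or_imp, forall_and, hab] using fun x y h => h1 (x, y) h
      · intro p hp
        rcases List.mem_append.1 hp with h | h
        · exact (h2 p h).trans (Nat.lt_succ_self _)
        · simp [List.mem_singleton.1 h]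
      · rw [List.map_append, List.pairwise_append]
        refine ⟨h3, by simp, fun x hx y hy => ?_⟩
        obtain ⟨p, hp, rfl⟩ := List.mem_map.1 hx
        obtain rfl : y = b := by simpa using hy
        exact h2 p hp
      · simp [h4, mul_assoc]

end Factorization

section RootTuples

variable {α : Type*} {n : ℕ}

/-- Every cycle of `σ` contains exactly one entry of `R`. -/
def IsRootTuple (σ : Perm α) (R : Fin n → α) : Prop :=
  ∀ x, ∃! i, σ.SameCycle (R i) x

theorem IsRootTuple.bijective_mk {σ : Perm α} {R : Fin n → α} (h : IsRootTuple σ R) :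
    Function.Bijective fun i => Quot.mk σ.SameCycle (R i) := by
  constructor
  · intro i j hij
    exact (h (R j)).unique (mk_eq_iff_sameCycle.1 hij) (.refl _ _)
  · rintro ⟨x⟩
    obtain ⟨i, hi, -⟩ := h x
    exact ⟨i, Quot.sound hi⟩

theorem isRootTuple_of_bijective_mk {σ : Perm α} {R : Fin n → α}
    (h : Function.Bijective fun i => Quot.mk σ.SameCycle (R i)) : IsRootTuple σ R := fun x => by
  obtain ⟨i, hi⟩ := h.2 (Quot.mk _ x)
  exact ⟨i, mk_eq_iff_sameCycle.1 hi,
    fun j hj => h.1 ((mk_eq_iff_sameCycle.2 hj).trans hi.symm)⟩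

theorem IsRootTuple.exists_zpow {σ : Perm α} {R : Fin n → α} (h : IsRootTuple σ R) (x : α) :
    ∃ i, ∃ j : ℤ, (σ ^ j) (R i) = x :=
  (h x).exists

theorem IsRootTuple.conj {σ : Perm α} {R : Fin n → α} (h : IsRootTuple σ R) (φ : Perm α) :
    IsRootTuple (φ * σ * φ⁻¹) (φ ∘ R) := fun x => by
  simpa [Perm.sameCycle_conj] using h (φ⁻¹ x)

/-- A permutation commuting with `σ` is determined by its values on a root tuple. -/
theorem IsRootTuple.perm_ext {σ φ ψ : Perm α} {R : Fin n → α} (h : IsRootTuple σ R)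
    (hφ : Commute φ σ) (hψ : Commute ψ σ) (hR : ∀ i, φ (R i) = ψ (R i)) : φ = ψ := by
  ext x
  obtain ⟨i, j, rfl⟩ := h.exists_zpow x
  rw [← Perm.mul_apply, ← Perm.mul_apply, (hφ.zpow_right j).eq, (hψ.zpow_right j).eq,
    Perm.mul_apply, Perm.mul_apply, hR]

theorem IsRootTuple.exists_map [Finite α] {σ : Perm α} {R R' : Fin n → α} (h : IsRootTuple σ R)
    (hs : ∀ i, orbitSize σ (R i) = orbitSize σ (R' i)) :
    ∃ f : α → α, ∀ i (j : ℤ), f ((σ ^ j) (R i)) = (σ ^ j) (R' i) := by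
  choose idx e he using h.exists_zpow
  refine ⟨fun x => (σ ^ e x) (R' (idx x)), fun i j => ?_⟩
  have hi : idx ((σ ^ j) (R i)) = i :=
    (h ((σ ^ j) (R i))).unique ⟨_, he _⟩ ⟨j, rfl⟩
  have := he ((σ ^ j) (R i))
  rw [hi, zpow_apply_eq_zpow_apply_iff, hs, ← zpow_apply_eq_zpow_apply_iff] at this
  simpa only [hi] using this

theorem IsRootTuple.exists_commute [Finite α] {σ : Perm α} {R R' : Fin n → α}
    (h : IsRootTuple σ R) (h' : IsRootTuple σ R')
    (hs : ∀ i, orbitSize σ (R i) = orbitSize σ (R' i)) :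
    ∃ φ : Perm α, Commute φ σ ∧ ∀ i, φ (R i) = R' i := by
  obtain ⟨f, hf⟩ := h.exists_map hs
  obtain ⟨g, hg⟩ := h'.exists_map fun i => (hs i).symm
  refine ⟨⟨f, g, fun x => ?_, fun x => ?_⟩, Equiv.ext fun x => ?_, fun i => hf i 0⟩
  · obtain ⟨i, j, rfl⟩ := h.exists_zpow x
    rw [hf, hg]
  · obtain ⟨i, j, rfl⟩ := h'.exists_zpow x
    rw [hg, hf]
  · obtain ⟨i, j, rfl⟩ := h.exists_zpow x
    change f (σ ((σ ^ j) (R i))) = σ (f ((σ ^ j) (R i)))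
    rw [hf, ← Perm.mul_apply, ← zpow_one_add, hf, zpow_one_add, Perm.mul_apply]

variable [Fintype α] [DecidableEq α]

theorem IsRootTuple.coe_ofFn_orbitSize {σ : Perm α} {R : Fin n → α} (h : IsRootTuple σ R) :
    (List.ofFn fun i => orbitSize σ (R i) : Multiset ℕ) = fullCycleType σ := by
  classical
  have := Fintype.ofFinite (Quot σ.SameCycle)
  rw [← map_orbitSize_out, ← Fin.univ_val_map,
    ← Multiset.map_univ_val_equiv (Equiv.ofBijective _ h.bijective_mk), Multiset.map_map]
  refine Multiset.map_congr rfl fun i _ => orbitSize_eq_of_sameCycle ?_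
  exact mk_eq_iff_sameCycle.1 (Quot.out_eq _).symm

theorem exists_isRootTuple {σ : Perm α} {s : Multiset ℕ} (hσ : fullCycleType σ = s) :
    ∃ R : Fin (Multiset.card s) → α,
      IsRootTuple σ R ∧ (List.ofFn fun i => orbitSize σ (R i)) = s.sort (· ≤ ·) := by
  classical
  have := Fintype.ofFinite (Quot σ.SameCycle)
  have hcard : Fintype.card (Quot σ.SameCycle) = Multiset.card s := by
    rw [← hσ, ← map_orbitSize_out, Multiset.card_map]
    rfl
  let e := (Fintype.equivFinOfCardEq hcard).symm
  let f : Fin (Multiset.card s) → ℕ := fun i => orbitSize σ (e i).out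
  have hR : IsRootTuple σ fun i => (e (Tuple.sort f i)).out :=
    isRootTuple_of_bijective_mk (by
      simp only [Quot.out_eq]
      exact ((Tuple.sort f).trans e).bijective)
  refine ⟨_, hR, List.Perm.eq_of_pairwise' (r := (· ≤ ·)) ?_ (Multiset.pairwise_sort _ _) ?_⟩
  · exact (List.sortedLE_ofFn_iff.2 (Tuple.monotone_sort f)).pairwise
  · rw [← Multiset.coe_eq_coe, hR.coe_ofFn_orbitSize, Multiset.sort_eq, hσ]

theorem card_rootTuples {σ : Perm α} {s : Multiset ℕ} (hσ : fullCycleType σ = s) :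
    Nat.card {R : Fin (Multiset.card s) → α //
      IsRootTuple σ R ∧ (List.ofFn fun i => orbitSize σ (R i)) = s.sort (· ≤ ·)} =
      Nat.card (Subgroup.centralizer {σ}) := by
  obtain ⟨R, hR, hs⟩ := exists_isRootTuple hσ
  have hconj : ∀ c : Subgroup.centralizer {σ}, c.1 * σ * c.1⁻¹ = σ := fun c => by
    rw [Subgroup.mem_centralizer_singleton_iff.1 c.2, mul_inv_cancel_right]
  have hcomm : ∀ c : Subgroup.centralizer {σ}, Commute c.1 σ := fun c =>
    Subgroup.mem_centralizer_singleton_iff.1 c.2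
  symm
  refine Nat.card_congr (Equiv.ofBijective (fun c => ⟨c.1 ∘ R, ?_, ?_⟩) ⟨?_, ?_⟩)
  · simpa [hconj] using hR.conj c.1
  · rw [← hs]
    congr 1
    funext i
    simpa [hconj] using orbitSize_conj c.1 σ (R i)
  · intro c c' h
    exact Subtype.ext (hR.perm_ext (hcomm c) (hcomm c') (congrFun (congrArg Subtype.val h)))
  · rintro ⟨R', hR', hs'⟩
    obtain ⟨φ, hφ, h⟩ := hR.exists_commute hR'
      (congrFun (List.ofFn_injective (hs.trans hs'.symm)))
    exact ⟨⟨φ, Subgroup.mem_centralizer_singleton_iff.2 hφ⟩, Subtype.ext (funext h)⟩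

theorem card_centralizer_eq_zPart {d : ℕ} {σ : Perm (Fin d)} {lam : Nat.Partition d}
    (hσ : fullCycleType σ = lam.parts) :
    Nat.card (Subgroup.centralizer {σ}) = zPart lam := by
  have h1 : 1 ∉ σ.cycleType := fun h => (Perm.one_lt_of_mem_cycleType h).ne rfl
  rw [Perm.nat_card_centralizer, zPart, ← hσ, fullCycleType, Multiset.prod_add,
    Multiset.prod_replicate, one_pow, mul_one, mul_comm (Nat.factorial _), mul_assoc,
    Perm.sum_cycleType]
  congr 1
  set f := Fintype.card (Fin d) - σ.support.card
  have hc : ∀ j ∈ σ.cycleType.toFinset,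
      (σ.cycleType + Multiset.replicate f 1).count j = σ.cycleType.count j := fun j hj => by
    have : j ≠ 1 := by rintro rfl; exact h1 (Multiset.mem_toFinset.1 hj)
    simp [Multiset.count_replicate, this.symm]
  rcases Nat.eq_zero_or_pos f with h | h
  · simp [h]
  · have : (σ.cycleType + Multiset.replicate f 1).toFinset = insert 1 σ.cycleType.toFinset := by
      ext j
      simp [h.ne']
    rw [this, Finset.prod_insert (by simpa using h1), Multiset.count_add,
      Multiset.count_eq_zero_of_notMem h1, Multiset.count_replicate_self, zero_add]
    exact congrArg _ (Finset.prod_congr rfl fun j hj => by rw [hc j hj])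

end RootTuples

section Dessins

theorem DessinData.ext_of_eq {m n : ℕ} {M M' : DessinData m n} (hr : M.tr = M'.tr)
    (hb : M.tb = M'.tb) (hR : M.R = M'.R) : M = M' := by
  obtain ⟨tr, tb, tv, R, rel, _⟩ := M
  obtain ⟨tr', tb', tv', R', rel', _⟩ := M'
  obtain rfl : tr = tr' := hr
  obtain rfl : tb = tb' := hb
  obtain rfl : R = R' := hR
  obtain rfl : tv = tv' := mul_left_cancel (rel.trans rel'.symm)
  rfl

theorem DessinData.tv_eq {m n : ℕ} (M : DessinData m n) : M.tv = (M.tr * M.tb)⁻¹ :=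
  eq_inv_of_mul_eq_one_right M.rel

/-- Relabelling the edges of a dessin. -/
instance {m n : ℕ} : MulAction (Perm (Fin m)) (DessinData m n) where
  smul φ M :=
    { tr := φ * M.tr * φ⁻¹
      tb := φ * M.tb * φ⁻¹
      tv := φ * M.tv * φ⁻¹
      R := φ ∘ M.R
      rel := by
        have : φ * (M.tr * M.tb * M.tv) * φ⁻¹ = 1 := by rw [M.rel, mul_one, mul_inv_cancel]
        rw [← this]
        group
      unique_root := IsRootTuple.conj M.unique_root φ }
  one_smul M := DessinData.ext_of_eq (by change 1 * M.tr * 1⁻¹ = _; group)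
    (by change 1 * M.tb * 1⁻¹ = _; group) rfl
  mul_smul φ ψ M := DessinData.ext_of_eq
    (by change φ * ψ * M.tr * (φ * ψ)⁻¹ = φ * (ψ * M.tr * ψ⁻¹) * φ⁻¹; group)
    (by change φ * ψ * M.tb * (φ * ψ)⁻¹ = φ * (ψ * M.tb * ψ⁻¹) * φ⁻¹; group) rfl

variable {m n : ℕ}

theorem smul_tr (φ : Perm (Fin m)) (M : DessinData m n) : (φ • M).tr = φ * M.tr * φ⁻¹ := rfl

theorem smul_tb (φ : Perm (Fin m)) (M : DessinData m n) : (φ • M).tb = φ * M.tb * φ⁻¹ := rfl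

theorem smul_tv (φ : Perm (Fin m)) (M : DessinData m n) : (φ • M).tv = φ * M.tv * φ⁻¹ := rfl

theorem smul_R (φ : Perm (Fin m)) (M : DessinData m n) (i : Fin n) : (φ • M).R i = φ (M.R i) := rfl

theorem dessinEquivRel_iff {M M' : DessinData m n} :
    DessinEquivRel M M' ↔ ∃ φ : Perm (Fin m), φ • M = M' := by
  refine exists_congr fun φ => ⟨fun ⟨hr, hb, _, hR⟩ => DessinData.ext_of_eq hr hb (funext hR), ?_⟩
  rintro rfl
  exact ⟨rfl, rfl, rfl, fun _ => rfl⟩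

/-- A dessin has no nontrivial automorphism. -/
theorem DessinData.eq_one_of_smul_eq {φ : Perm (Fin m)} {M : DessinData m n} (h : φ • M = M) :
    φ = 1 := by
  refine IsRootTuple.perm_ext M.unique_root ?_ (Commute.one_left _)
    fun i => congrFun (congrArg DessinData.R h) i
  have : φ * M.tb * φ⁻¹ = M.tb := congrArg DessinData.tb h
  exact mul_inv_eq_iff_eq_mul.1 this

theorem cycleCount_conj {α : Type*} (φ σ : Perm α) :
    cycleCount (φ * σ * φ⁻¹) = cycleCount σ :=
  (Nat.card_congr (Quot.congr φ fun _ _ => by simp [Perm.sameCycle_conj])).symm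

variable {d k : ℕ} {lam mu : Nat.Partition d}

/-- The dessins with blue face degrees `lam`, red face degrees `mu` and `d - k` vertices. -/
abbrev TypedDessin (d k : ℕ) (lam mu : Nat.Partition d) : Type :=
  {M : DessinData d (Multiset.card lam.parts) //
    (List.ofFn fun i => orbitSize M.tb (M.R i)) = lam.parts.sort (· ≤ ·) ∧
    fullCycleType M.tr = mu.parts ∧ d = cycleCount M.tv + k}

noncomputable instance : MulAction (Perm (Fin d)) (TypedDessin d k lam mu) where
  smul φ M := ⟨φ • M.1, by
    simpa only [smul_tr, smul_tb, smul_tv, smul_R, fullCycleType_conj, cycleCount_conj,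
      orbitSize_conj] using M.2⟩
  one_smul M := Subtype.ext (one_smul _ M.1)
  mul_smul φ ψ M := Subtype.ext (mul_smul φ ψ M.1)

theorem card_typedDessin_eq_card_quot_mul :
    Nat.card (TypedDessin d k lam mu) =
      Nat.card (Quot fun M M' : TypedDessin d k lam mu => DessinEquivRel M.1 M'.1) *
        d.factorial := by
  have hfree : ∀ M : TypedDessin d k lam mu,
      MulAction.stabilizer (Perm (Fin d)) M = ⊥ := fun M => by
    refine (Subgroup.eq_bot_iff_forall _).2 fun φ hφ => ?_
    exact DessinData.eq_one_of_smul_eq (congrArg Subtype.val (MulAction.mem_stabilizer_iff.1 hφ))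
  rw [Nat.card_congr (MulAction.selfEquivOrbitsQuotientProd hfree), Nat.card_prod,
    Nat.card_eq_fintype_card (α := Perm (Fin d)), Fintype.card_perm, Fintype.card_fin]
  congr 1
  refine Nat.card_congr (Quot.congrRight fun M M' => ?_)
  rw [dessinEquivRel_iff]
  refine Iff.trans MulAction.mem_orbit_symm (exists_congr fun φ => ?_)
  exact Subtype.ext_iff

/-- The pairs of permutations which are the blue and red faces of some dessin. -/
abbrev FacePair (d k : ℕ) (lam mu : Nat.Partition d) : Type :=
  {p : Perm (Fin d) × Perm (Fin d) // fullCycleType p.1 = lam.parts ∧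
    fullCycleType p.2 = mu.parts ∧ d = cycleCount (p.2 * p.1)⁻¹ + k}

/-- A dessin is a pair of permutations with a root tuple for the first. -/
def typedDessinEquiv (d k : ℕ) (lam mu : Nat.Partition d) :
    TypedDessin d k lam mu ≃ Σ p : FacePair d k lam mu,
      {R : Fin (Multiset.card lam.parts) → Fin d // IsRootTuple p.1.1 R ∧
        (List.ofFn fun i => orbitSize p.1.1 (R i)) = lam.parts.sort (· ≤ ·)} where
  toFun M := ⟨⟨(M.1.tb, M.1.tr), by
      rw [← IsRootTuple.coe_ofFn_orbitSize M.1.unique_root, M.2.1, Multiset.sort_eq],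
      M.2.2.1, M.1.tv_eq ▸ M.2.2.2⟩, ⟨M.1.R, M.1.unique_root, M.2.1⟩⟩
  invFun q := ⟨⟨q.1.1.2, q.1.1.1, (q.1.1.2 * q.1.1.1)⁻¹, q.2.1, mul_inv_cancel _, q.2.2.1⟩,
    q.2.2.2, q.1.2.2.1, q.1.2.2.2⟩
  left_inv _ := Subtype.ext (DessinData.ext_of_eq rfl rfl rfl)
  right_inv _ := rfl

theorem card_typedDessin_eq_zPart_mul (lam mu : Nat.Partition d) :
    Nat.card (TypedDessin d k lam mu) = zPart lam * Nat.card (FacePair d k lam mu) := by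
  classical
  rw [Nat.card_congr (typedDessinEquiv d k lam mu), Nat.card_sigma,
    Finset.sum_congr rfl fun p _ =>
      (card_rootTuples p.2.1).trans (card_centralizer_eq_zPart p.2.1),
    Finset.sum_const, Finset.card_univ, smul_eq_mul, mul_comm, Nat.card_eq_fintype_card]

/-- Strictly monotone factorizations are unique, so the tuples counted by the strictly monotone
Hurwitz numbers are determined by their two outer permutations. -/
theorem card_facePair_eq_card_hurwitzTuples :
    Nat.card (FacePair d k lam mu) =
      Nat.card {t : Perm (Fin d) × List (Perm (Fin d)) × Perm (Fin d) //
        fullCycleType t.1 = lam.parts ∧ fullCycleType t.2.2 = mu.parts ∧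
        t.2.1.length = k ∧ IsStrictlyMonotone t.2.1 ∧
        t.1 * t.2.1.prod * t.2.2 = 1} := by
  have hprod : ∀ a b c : Perm (Fin d), a * b * c = 1 ↔ b = (c * a)⁻¹ := fun a b c => by
    rw [mul_eq_one_iff_eq_inv, mul_inv_rev, eq_inv_mul_iff_mul_eq]
  symm
  refine Nat.card_congr (Equiv.ofBijective (fun t => ⟨(t.1.1, t.1.2.2), t.2.1, t.2.2.1, ?_⟩)
    ⟨?_, ?_⟩)
  · obtain ⟨⟨a, l, c⟩, _, _, hk, hl, h⟩ := t
    rw [← (hprod _ _ _).1 h, ← hk]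
    exact hl.cycleCount_prod_add_length.symm
  · rintro ⟨⟨a, l, c⟩, _, _, _, hl, h⟩ ⟨⟨a', l', c'⟩, _, _, _, hl', h'⟩ heq
    obtain ⟨rfl, rfl⟩ := Prod.mk.inj (congrArg Subtype.val heq)
    obtain rfl := hl.eq_of_prod_eq hl' (((hprod _ _ _).1 h).trans ((hprod _ _ _).1 h').symm)
    rfl
  · rintro ⟨⟨a, c⟩, ha, hc, hk⟩
    obtain ⟨l, hl, hl'⟩ := exists_isStrictlyMonotone_prod_eq (c * a)⁻¹
    have := hl.cycleCount_prod_add_length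
    rw [hl'] at this
    exact ⟨⟨(a, l, c), ha, hc, by simp only at hk ⊢; omega, hl, (hprod _ _ _).2 hl'⟩, rfl⟩

end Dessins

end FSM

open FSM in
/-- **Dessins d'enfant are enumerated by strictly monotone Hurwitz numbers.**
For partitions `λ, μ ⊢ d` (with the parts of `λ` listed in a fixed, sorted, order) and
`k ≥ 0`, the number `D_k(λ; μ)` of equivalence classes of dessins d'enfant on a set of
`d` edges whose `i`-th blue face has degree `λᵢ`, whose red faces have cycle type `μ`,
and whose number of edges exceeds the number of vertices by `k`, satisfies
`D_k(λ; μ) = z(λ) · H^<_k(λ; μ)`. -/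
theorem dessin_count_eq_zPart_mul_Hstrict
    (d k : ℕ) (hd : 0 < d) (lam mu : Nat.Partition d) :
    (Nat.card (Quot (fun M M' : {M : DessinData d (Multiset.card lam.parts) //
        (List.ofFn fun i => orbitSize M.tb (M.R i)) = lam.parts.sort (· ≤ ·) ∧
        fullCycleType M.tr = mu.parts ∧
        d = cycleCount M.tv + k} => DessinEquivRel M.1 M'.1)) : ℚ) =
      (zPart lam : ℚ) * Hstrict d k lam mu := by
  have h1 : Nat.card (TypedDessin d k lam mu) = _ * d.factorial :=
    card_typedDessin_eq_card_quot_mul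
  have h2 := card_typedDessin_eq_zPart_mul (k := k) lam mu
  rw [h1, card_facePair_eq_card_hurwitzTuples] at h2
  rw [Hstrict, mul_div_assoc', eq_div_iff (by exact_mod_cast d.factorial_ne_zero)]
  exact_mod_cast h2
end
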